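/- arXiv:1303.5503 — 6 statements merged into one kernel-verified Lean document; each statement's English description precedes it below -/
import Mathlib

section
/- Let n ≥ 1, let X = ∏_{i=1}^{n} [a_i, b_i] ⊆ ℝⁿ be a box (a product of nonempty closed intervals), and let f : ℝⁿ → ℝⁿ be differentiable on an open set containing X, with Jacobian matrix f'(x). Let A_lo, A_hi be n×n real matrices forming an interval enclosure of the Jacobian on X, i.e. for every x ∈ X and all indices i, j one has A_lo i j ≤ f'(x) i j ≤ A_hi i j, and let 𝒜 = {A : ∀ i j, A_lo i j ≤ A i j ≤ A_hi i j}. Fix y ∈ X and an n×n real matrix Y, and define the Krawczyk set K(y, X) = { y − Y·f(y) + (I − Y·A)·(x − y) : x ∈ X, A ∈ 𝒜 }. Then every zero of f in X belongs to K(y, X): if x* ∈ X and f(x*) = 0, then x* ∈ K(y, X). -/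
/-- Property 2.1(1): every zero of `f` in the box `X` belongs to the Krawczyk set
`K(y, X) = { y − Y·f(y) + (I − Y·A)·(x − y) : x ∈ X, A ∈ 𝒜 }`. -/
theorem krawczyk_contains_zeros
    (n : ℕ) (hn : 1 ≤ n) (a b : Fin n → ℝ) (hab : ∀ i, a i ≤ b i)
    (X : Set (Fin n → ℝ)) (hX : X = {x | ∀ i, x i ∈ Set.Icc (a i) (b i)})
    (f : (Fin n → ℝ) → (Fin n → ℝ)) (J : (Fin n → ℝ) → Matrix (Fin n) (Fin n) ℝ)
    (U : Set (Fin n → ℝ)) (hU : IsOpen U) (hXU : X ⊆ U)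
    (hf : ∀ x ∈ U, HasFDerivAt f ((Matrix.mulVecLin (J x)).toContinuousLinearMap) x)
    (Alo Ahi : Matrix (Fin n) (Fin n) ℝ)
    (hencl : ∀ x ∈ X, ∀ i j, Alo i j ≤ J x i j ∧ J x i j ≤ Ahi i j)
    (𝒜 : Set (Matrix (Fin n) (Fin n) ℝ))
    (h𝒜 : 𝒜 = {A | ∀ i j, Alo i j ≤ A i j ∧ A i j ≤ Ahi i j})
    (y : Fin n → ℝ) (hy : y ∈ X) (Y : Matrix (Fin n) (Fin n) ℝ)
    (K : Set (Fin n → ℝ))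
    (hK : K = {z | ∃ x ∈ X, ∃ A ∈ 𝒜,
      z = y - Y.mulVec (f y) + (1 - Y * A).mulVec (x - y)})
    (xs : Fin n → ℝ) (hxs : xs ∈ X) (hfxs : f xs = 0) :
    xs ∈ K := by
  have hconv : Convex ℝ X := by
    have : X = Set.Icc a b := by
      rw [hX]; ext x
      simp only [Set.mem_setOf_eq, Set.mem_Icc, Pi.le_def, forall_and]
    rw [this]; exact convex_Icc a b
  have key : ∀ i, ∃ z ∈ X, f xs i - f y i = (J z).mulVec (xs - y) i := by
    intro i
    obtain ⟨z, hz, h⟩ := domain_mvt (f := fun x => f x i) (s := X) (x := y) (y := xs)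
      (f' := fun x => (ContinuousLinearMap.proj (R := ℝ) (φ := fun _ : Fin n => ℝ) i).comp
        ((Matrix.mulVecLin (J x)).toContinuousLinearMap))
      (fun x hx => ((hasFDerivAt_pi'.1 (hf x (hXU hx))) i).hasFDerivWithinAt) hconv hy hxs
    exact ⟨z, hconv.segment_subset hy hxs hz, by simpa using h⟩
  choose z hz h using key
  let A : Matrix (Fin n) (Fin n) ℝ := fun i j => J (z i) i j
  have hA : A.mulVec (xs - y) = - f y := by
    funext i
    have h1 := h i
    rw [hfxs] at h1
    simp only [Pi.zero_apply, zero_sub] at h1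
    rw [Pi.neg_apply, h1]
    rfl
  rw [hK]
  refine ⟨xs, hxs, A, ?_, ?_⟩
  · rw [h𝒜]
    exact fun i j => hencl (z i) (hz i) i j
  · rw [Matrix.sub_mulVec, ← Matrix.mulVec_mulVec, hA, Matrix.one_mulVec, Matrix.mulVec_neg]
    abel
end

section
/- Let n ≥ 1, let X = ∏_{i=1}^{n} [a_i, b_i] ⊆ ℝⁿ be a box, let f : ℝⁿ → ℝⁿ be differentiable on an open set containing X, let A_lo, A_hi be an interval enclosure of the Jacobian of f on X with associated matrix set 𝒜, let y ∈ X, let Y be a nonsingular n×n real matrix, and let K(y, X) be the Krawczyk set. If K(y, X) is contained in the topological interior of X, then f has exactly one zero in X, i.e. there exists a unique x* ∈ X with f(x*) = 0. -/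
/-- Property 2.1(2): if the Krawczyk set `K(y, X)` is contained in the topological
interior of the box `X`, then `f` has exactly one zero in `X`. -/
theorem krawczyk_subset_interior_unique_zero
    (n : ℕ) (hn : 1 ≤ n) (a b : Fin n → ℝ) (hab : ∀ i, a i ≤ b i)
    (X : Set (Fin n → ℝ)) (hX : X = {x | ∀ i, x i ∈ Set.Icc (a i) (b i)})
    (f : (Fin n → ℝ) → (Fin n → ℝ)) (J : (Fin n → ℝ) → Matrix (Fin n) (Fin n) ℝ)
    (U : Set (Fin n → ℝ)) (hU : IsOpen U) (hXU : X ⊆ U)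
    (hf : ∀ x ∈ U, HasFDerivAt f ((Matrix.mulVecLin (J x)).toContinuousLinearMap) x)
    (Alo Ahi : Matrix (Fin n) (Fin n) ℝ)
    (hencl : ∀ x ∈ X, ∀ i j, Alo i j ≤ J x i j ∧ J x i j ≤ Ahi i j)
    (𝒜 : Set (Matrix (Fin n) (Fin n) ℝ))
    (h𝒜 : 𝒜 = {A | ∀ i j, Alo i j ≤ A i j ∧ A i j ≤ Ahi i j})
    (y : Fin n → ℝ) (hy : y ∈ X) (Y : Matrix (Fin n) (Fin n) ℝ)
    (hY : Y.det ≠ 0)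
    (K : Set (Fin n → ℝ))
    (hK : K = {z | ∃ x ∈ X, ∃ A ∈ 𝒜,
      z = y - Y.mulVec (f y) + (1 - Y * A).mulVec (x - y)})
    (hKint : K ⊆ interior X) :
    ∃! xs, xs ∈ X ∧ f xs = 0 := by
  classical
  have hX' : X = Set.univ.pi (fun i => Set.Icc (a i) (b i)) := by
    rw [hX]; ext x; simp only [Set.mem_ofPred_eq, Set.mem_univ_pi]
  have hXc : IsCompact X := by rw [hX']; exact isCompact_univ_pi (fun i => isCompact_Icc)
  have hXconv : Convex ℝ X := by rw [hX']; exact convex_pi (fun i _ => convex_Icc _ _)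
  have hint : ∀ x ∈ interior X, ∀ i, a i < x i ∧ x i < b i := by
    intro x hx i
    rw [hX', interior_pi_set Set.finite_univ] at hx
    have := hx i (Set.mem_univ i)
    simp only [interior_Icc] at this
    exact this
  -- the row sums
  have hrow : ∀ A ∈ 𝒜, ∀ i, ∑ j, |(1 - Y * A) i j| * (b j - a j) < b i - a i := by
    intro A hA i
    set R := 1 - Y * A with hR
    have key : ∀ x ∈ X, a i < (y - Y.mulVec (f y) + R.mulVec (x - y)) i ∧
        (y - Y.mulVec (f y) + R.mulVec (x - y)) i < b i := by
      intro x hx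
      refine hint _ (hKint ?_) i
      rw [hK]
      exact ⟨x, hx, A, hA, rfl⟩
    have h1 := (key (fun j => if 0 ≤ R i j then b j else a j) (by
      rw [hX]; intro j; dsimp only; split_ifs
      · exact ⟨hab j, le_rfl⟩
      · exact ⟨le_rfl, hab j⟩)).2
    have h2 := (key (fun j => if 0 ≤ R i j then a j else b j) (by
      rw [hX]; intro j; dsimp only; split_ifs
      · exact ⟨le_rfl, hab j⟩
      · exact ⟨hab j, le_rfl⟩)).1
    simp only [Pi.add_apply, Matrix.mulVec, dotProduct, Pi.sub_apply] at h1 h2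
    have h3 : ∑ j, |R i j| * (b j - a j) =
        ∑ j, R i j * ((if 0 ≤ R i j then b j else a j) - y j) -
        ∑ j, R i j * ((if 0 ≤ R i j then a j else b j) - y j) := by
      rw [← Finset.sum_sub_distrib]
      refine Finset.sum_congr rfl fun j _ => ?_
      split_ifs with h
      · rw [abs_of_nonneg h]; ring
      · rw [abs_of_neg (not_le.mp h)]; ring
    linarith
  have hmv : ∀ x ∈ X, ∀ x' ∈ X, ∃ A ∈ 𝒜, f x - f x' = A.mulVec (x - x') := by
    intro x hx x' hx'
    have h : ∀ i, ∃ z ∈ X, f x i - f x' i = (J z).mulVec (x - x') i := by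
      intro i
      obtain ⟨z, hz, h⟩ := domain_mvt (f := fun u => f u i) (s := X) (x := x') (y := x)
        (f' := fun u => (ContinuousLinearMap.proj (R := ℝ) (φ := fun _ : Fin n => ℝ) i).comp
          ((Matrix.mulVecLin (J u)).toContinuousLinearMap))
        (fun u hu => (hasFDerivAt_pi'.1 (hf u (hXU hu)) i).hasFDerivWithinAt) hXconv hx' hx
      exact ⟨z, hXconv.segment_subset hx' hx hz, h⟩
    choose z hz h using h
    refine ⟨fun i j => J (z i) i j, ?_, ?_⟩
    · rw [h𝒜]; intro i j; exact hencl _ (hz i) i j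
    · ext i
      exact h i
  set g : (Fin n → ℝ) → (Fin n → ℝ) := fun x => x - Y.mulVec (f x) with hg
  have hgd : ∀ x ∈ X, ∀ x' ∈ X, ∃ A ∈ 𝒜, g x - g x' = (1 - Y * A).mulVec (x - x') := by
    intro x hx x' hx'
    obtain ⟨A, hA, h⟩ := hmv x hx x' hx'
    refine ⟨A, hA, ?_⟩
    rw [Matrix.sub_mulVec, Matrix.one_mulVec, ← Matrix.mulVec_mulVec, ← h, Matrix.mulVec_sub]
    simp only [hg]; abel
  have hgK : ∀ x ∈ X, g x ∈ interior X := by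
    intro x hx
    obtain ⟨A, hA, h⟩ := hgd x hx y hy
    apply hKint
    rw [hK]
    refine ⟨x, hx, A, hA, ?_⟩
    rw [← h]; simp only [hg]; abel
  have hgX : ∀ x ∈ X, g x ∈ X := fun x hx => interior_subset (hgK x hx)
  have hw : ∀ i, 0 < b i - a i := by
    intro i
    have := hint _ (hgK y hy) i
    linarith
  set N : (Fin n → ℝ) → ℝ := fun v => ‖(fun i => v i / (b i - a i) : Fin n → ℝ)‖ with hN
  have hNc : Continuous N := by
    apply Continuous.norm
    fun_prop
  have hN0 : ∀ v, v ≠ 0 → 0 < N v := by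
    intro v hv
    rw [hN]
    apply norm_pos_iff.2
    contrapose! hv
    ext i
    have := congrFun hv i
    simpa [(hw i).ne'] using this
  have hNle : ∀ v i, |v i| ≤ N v * (b i - a i) := by
    intro v i
    have h := norm_le_pi_norm (fun i => v i / (b i - a i) : Fin n → ℝ) i
    rw [Real.norm_eq_abs, abs_div, abs_of_pos (hw i), div_le_iff₀ (hw i)] at h
    exact h
  have hcontr : ∀ x ∈ X, ∀ x' ∈ X, x ≠ x' → N (g x - g x') < N (x - x') := by
    intro x hx x' hx' hne
    have hpos := hN0 _ (sub_ne_zero.2 hne)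
    obtain ⟨A, hA, h⟩ := hgd x hx x' hx'
    rw [h]
    refine (pi_norm_lt_iff hpos).2 fun i => ?_
    rw [Real.norm_eq_abs, abs_div, abs_of_pos (hw i), div_lt_iff₀ (hw i)]
    calc |(1 - Y * A).mulVec (x - x') i|
        ≤ ∑ j, |(1 - Y * A) i j * (x - x') j| := by
          simp only [Matrix.mulVec, dotProduct]
          exact Finset.abs_sum_le_sum_abs _ _
      _ ≤ ∑ j, N (x - x') * (|(1 - Y * A) i j| * (b j - a j)) := by
          refine Finset.sum_le_sum fun j _ => ?_
          rw [abs_mul]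
          have := mul_le_mul_of_nonneg_left (hNle (x - x') j) (abs_nonneg ((1 - Y * A) i j))
          linarith
      _ = N (x - x') * ∑ j, |(1 - Y * A) i j| * (b j - a j) := by rw [Finset.mul_sum]
      _ < N (x - x') * (b i - a i) := mul_lt_mul_of_pos_left (hrow A hA i) hpos
  have hfc : ContinuousOn f X := fun x hx => (hf x (hXU hx)).continuousAt.continuousWithinAt
  have hgc : ContinuousOn g X :=
    continuousOn_id.sub ((Y.mulVecLin.continuous_of_finiteDimensional).comp_continuousOn hfc)
  obtain ⟨p, hp, hmin⟩ := hXc.exists_isMinOn ⟨y, hy⟩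
    (hNc.comp_continuousOn (hgc.sub continuousOn_id))
  have hfix : g p = p := by
    by_contra hne
    have h1 := hcontr _ (hgX p hp) p hp hne
    have h2 := hmin (hgX p hp)
    exact absurd h1 (not_lt.2 h2)
  have hz : ∀ x, f x = 0 → g x = x := by
    intro x hx; simp [hg, hx]
  refine ⟨p, ⟨hp, ?_⟩, ?_⟩
  · apply Matrix.eq_zero_of_mulVec_eq_zero hY
    exact sub_eq_self.1 hfix
  · rintro q ⟨hq, hq0⟩
    by_contra hne
    have := hcontr q hq p hp hne
    rw [hz q hq0, hfix] at this
    exact lt_irrefl _ this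
end

section
/- Let n ≥ 1, let X = ∏_{i=1}^{n} [a_i, b_i] ⊆ ℝⁿ be a box, let f : ℝⁿ → ℝⁿ be continuous on X and differentiable on an open set containing X, let A_lo, A_hi be an interval enclosure of the Jacobian of f on X with associated matrix set 𝒜, let y ∈ X, let Y be a nonsingular n×n real matrix, and let K(y, X) be the Krawczyk set. If K(y, X) ⊆ int(X) (the topological interior of X), then f has a zero in X: there exists x* ∈ X with f(x*) = 0. -/
/-- Property 2.1(3): if the Krawczyk set `K(y, X)` is contained in the topological
interior of the box `X`, then `f` has a zero in `X`. -/
theorem krawczyk_subset_interior_exists_zero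
    (n : ℕ) (hn : 1 ≤ n) (a b : Fin n → ℝ) (hab : ∀ i, a i ≤ b i)
    (X : Set (Fin n → ℝ)) (hX : X = {x | ∀ i, x i ∈ Set.Icc (a i) (b i)})
    (f : (Fin n → ℝ) → (Fin n → ℝ)) (hfc : ContinuousOn f X)
    (J : (Fin n → ℝ) → Matrix (Fin n) (Fin n) ℝ)
    (U : Set (Fin n → ℝ)) (hU : IsOpen U) (hXU : X ⊆ U)
    (hf : ∀ x ∈ U, HasFDerivAt f ((Matrix.mulVecLin (J x)).toContinuousLinearMap) x)
    (Alo Ahi : Matrix (Fin n) (Fin n) ℝ)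
    (hencl : ∀ x ∈ X, ∀ i j, Alo i j ≤ J x i j ∧ J x i j ≤ Ahi i j)
    (𝒜 : Set (Matrix (Fin n) (Fin n) ℝ))
    (h𝒜 : 𝒜 = {A | ∀ i j, Alo i j ≤ A i j ∧ A i j ≤ Ahi i j})
    (y : Fin n → ℝ) (hy : y ∈ X) (Y : Matrix (Fin n) (Fin n) ℝ)
    (hY : Y.det ≠ 0)
    (K : Set (Fin n → ℝ))
    (hK : K = {z | ∃ x ∈ X, ∃ A ∈ 𝒜,
      z = y - Y.mulVec (f y) + (1 - Y * A).mulVec (x - y)})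
    (hKint : K ⊆ interior X) :
    ∃ xs ∈ X, f xs = 0 := by
  have hXpi : X = Set.pi Set.univ (fun i => Set.Icc (a i) (b i)) := by
    rw [hX]; ext x; simp only [Set.mem_univ_pi]; rfl
  have hint : ∀ z ∈ interior X, ∀ i, a i < z i ∧ z i < b i := by
    intro z hz i
    rw [hXpi, interior_pi_set Set.finite_univ] at hz
    have : z i ∈ interior (Set.Icc (a i) (b i)) := hz i (Set.mem_univ i)
    rw [interior_Icc] at this
    exact this
  have hconv : Convex ℝ X := by
    rw [hXpi]; exact convex_pi (fun i _ => convex_Icc _ _)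
  have hcomp : IsCompact X := by
    rw [hXpi]; exact isCompact_univ_pi (fun i => isCompact_Icc)
  -- mean value form
  have hmv : ∀ x ∈ X, ∀ x' ∈ X, ∃ A ∈ 𝒜, f x - f x' = A.mulVec (x - x') := by
    intro x hx x' hx'
    have h1 : ∀ i, ∃ ξ ∈ X, f x i - f x' i = (J ξ).mulVec (x - x') i := by
      intro i
      obtain ⟨ξ, hξ, h⟩ := domain_mvt (f := fun z => f z i) (s := X) (x := x') (y := x)
        (f' := fun z => (ContinuousLinearMap.proj (R := ℝ) (φ := fun _ : Fin n => ℝ) i).comp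
          ((Matrix.mulVecLin (J z)).toContinuousLinearMap))
        (fun z hz => (hasFDerivAt_pi'.1 (hf z (hXU hz)) i).hasFDerivWithinAt) hconv hx' hx
      exact ⟨ξ, hconv.segment_subset hx' hx hξ, by simpa using h⟩
    choose ξ hξ h using h1
    refine ⟨Matrix.of fun i j => J (ξ i) i j, ?_, ?_⟩
    · rw [h𝒜]; exact fun i j => hencl _ (hξ i) i j
    · ext i
      have := h i
      simpa [Matrix.mulVec, dotProduct] using this
  have hmemK : ∀ x ∈ X, ∀ A ∈ 𝒜,
      y - Y.mulVec (f y) + (1 - Y * A).mulVec (x - y) ∈ interior X := by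
    intro x hx A hA
    apply hKint; rw [hK]; exact ⟨x, hx, A, hA, rfl⟩
  have hgmv : ∀ x ∈ X, ∀ x' ∈ X, ∃ A ∈ 𝒜,
      (x - Y.mulVec (f x)) - (x' - Y.mulVec (f x')) = (1 - Y * A).mulVec (x - x') := by
    intro x hx x' hx'
    obtain ⟨A, hA, h⟩ := hmv x hx x' hx'
    refine ⟨A, hA, ?_⟩
    rw [Matrix.sub_mulVec, Matrix.one_mulVec, ← Matrix.mulVec_mulVec, ← h, Matrix.mulVec_sub]
    abel
  have hgX : ∀ x ∈ X, x - Y.mulVec (f x) ∈ X := by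
    intro x hx
    obtain ⟨A, hA, h⟩ := hgmv x hx y hy
    have := interior_subset (hmemK x hx A hA)
    rw [← h] at this
    simpa using this
  have hw : ∀ i, 0 < b i - a i := by
    intro i
    obtain ⟨A, hA, -⟩ := hgmv y hy y hy
    have := hint _ (hmemK y hy A hA) i
    linarith [this.1, this.2]
  have hrow : ∀ A ∈ 𝒜, ∀ i, ∑ j, |(1 - Y * A) i j| * (b j - a j) < b i - a i := by
    intro A hA i
    set M := 1 - Y * A with hM
    have hp : (fun j => if 0 ≤ M i j then b j else a j) ∈ X := by
      rw [hX]; intro j; dsimp only; split_ifs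
      · exact ⟨hab j, le_rfl⟩
      · exact ⟨le_rfl, hab j⟩
    have hm : (fun j => if 0 ≤ M i j then a j else b j) ∈ X := by
      rw [hX]; intro j; dsimp only; split_ifs
      · exact ⟨le_rfl, hab j⟩
      · exact ⟨hab j, le_rfl⟩
    have h1 := (hint _ (hmemK _ hp A hA) i).2
    have h2 := (hint _ (hmemK _ hm A hA) i).1
    rw [← hM] at h1 h2
    have h3 : ∑ j, |M i j| * (b j - a j) =
        M.mulVec ((fun j => if 0 ≤ M i j then b j else a j) - y) i
        - M.mulVec ((fun j => if 0 ≤ M i j then a j else b j) - y) i := by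
      simp only [Matrix.mulVec, dotProduct]
      rw [← Finset.sum_sub_distrib]
      refine Finset.sum_congr rfl fun j _ => ?_
      simp only [Pi.sub_apply]
      split_ifs with hs
      · rw [abs_of_nonneg hs]; ring
      · rw [abs_of_neg (not_le.1 hs)]; ring
    rw [h3]
    simp only [Pi.add_apply] at h1 h2
    linarith
  let φ : (Fin n → ℝ) → ℝ := fun v => ‖fun i => v i / (b i - a i)‖
  have hcontr : ∀ A ∈ 𝒜, ∀ v : Fin n → ℝ, v ≠ 0 → φ ((1 - Y * A).mulVec v) < φ v := by
    intro A hA v hv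
    have hpos : 0 < φ v := by
      apply norm_pos_iff.2
      intro h0
      apply hv
      ext i
      have := congrFun h0 i
      simpa [(hw i).ne'] using this
    refine (pi_norm_lt_iff hpos).2 fun i => ?_
    rw [Real.norm_eq_abs, abs_div, abs_of_pos (hw i), div_lt_iff₀ (hw i)]
    calc |(1 - Y * A).mulVec v i| ≤ ∑ j, |(1 - Y * A) i j * v j| := by
          simp only [Matrix.mulVec, dotProduct]; exact Finset.abs_sum_le_sum_abs _ _
      _ ≤ ∑ j, φ v * (|(1 - Y * A) i j| * (b j - a j)) := by
          refine Finset.sum_le_sum fun j _ => ?_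
          have h := norm_le_pi_norm (fun i => v i / (b i - a i)) j
          rw [Real.norm_eq_abs, abs_div, abs_of_pos (hw j), div_le_iff₀ (hw j)] at h
          rw [abs_mul]
          calc _ ≤ |(1 - Y * A) i j| * (φ v * (b j - a j)) :=
                mul_le_mul_of_nonneg_left h (abs_nonneg _)
            _ = _ := by ring
      _ = φ v * ∑ j, |(1 - Y * A) i j| * (b j - a j) := by rw [Finset.mul_sum]
      _ < φ v * (b i - a i) := mul_lt_mul_of_pos_left (hrow A hA i) hpos
  have hφ : Continuous φ := by
    refine continuous_norm.comp (continuous_pi fun i => ?_)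
    exact (continuous_apply i).div_const _
  have hYf : ContinuousOn (fun x => Y.mulVec (f x)) X :=
    (Continuous.matrix_mulVec continuous_const continuous_id).comp_continuousOn hfc
  obtain ⟨x, hx, hmin⟩ := hcomp.exists_isMinOn ⟨y, hy⟩ (hφ.comp_continuousOn hYf)
  refine ⟨x, hx, ?_⟩
  have hzero : Y.mulVec (f x) = 0 := by
    by_contra hne
    have hgx := hgX x hx
    obtain ⟨A, hA, h⟩ := hgmv x hx _ hgx
    have h1 := hcontr A hA _ hne
    have h2 := hmin hgx
    simp only [Set.mem_ofPred_eq, Function.comp_apply] at h2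
    rw [sub_sub_cancel, sub_sub_cancel] at h
    rw [← h] at h1
    exact absurd h1 (not_lt.2 h2)
  exact Matrix.eq_zero_of_mulVec_eq_zero hY hzero
end

section
/- Let n ≥ 1, let X = ∏_{i=1}^{n} [a_i, b_i] ⊆ ℝⁿ be a box, let f : ℝⁿ → ℝⁿ be differentiable on an open set containing X, let A_lo, A_hi be an interval enclosure of the Jacobian of f on X with associated matrix set 𝒜, let y ∈ X, let Y be an n×n real matrix, and let K(y, X) be the Krawczyk set. If K(y, X) ∩ X = ∅, then f has no zero in X: there is no x* ∈ X with f(x*) = 0. -/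
/-- Property 2.1(4): if the Krawczyk set `K(y, X)` is disjoint from the box `X`,
then `f` has no zero in `X`. -/
theorem krawczyk_disjoint_no_zero
    (n : ℕ) (hn : 1 ≤ n) (a b : Fin n → ℝ) (hab : ∀ i, a i ≤ b i)
    (X : Set (Fin n → ℝ)) (hX : X = {x | ∀ i, x i ∈ Set.Icc (a i) (b i)})
    (f : (Fin n → ℝ) → (Fin n → ℝ)) (J : (Fin n → ℝ) → Matrix (Fin n) (Fin n) ℝ)
    (U : Set (Fin n → ℝ)) (hU : IsOpen U) (hXU : X ⊆ U)
    (hf : ∀ x ∈ U, HasFDerivAt f ((Matrix.mulVecLin (J x)).toContinuousLinearMap) x)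
    (Alo Ahi : Matrix (Fin n) (Fin n) ℝ)
    (hencl : ∀ x ∈ X, ∀ i j, Alo i j ≤ J x i j ∧ J x i j ≤ Ahi i j)
    (𝒜 : Set (Matrix (Fin n) (Fin n) ℝ))
    (h𝒜 : 𝒜 = {A | ∀ i j, Alo i j ≤ A i j ∧ A i j ≤ Ahi i j})
    (y : Fin n → ℝ) (hy : y ∈ X) (Y : Matrix (Fin n) (Fin n) ℝ)
    (K : Set (Fin n → ℝ))
    (hK : K = {z | ∃ x ∈ X, ∃ A ∈ 𝒜,
      z = y - Y.mulVec (f y) + (1 - Y * A).mulVec (x - y)})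
    (hdisj : K ∩ X = ∅) :
    ¬ ∃ xs ∈ X, f xs = 0 := by
  rintro ⟨xs, hxs, h0⟩
  have hconv : Convex ℝ X := by
    have : X = Set.pi Set.univ (fun i => Set.Icc (a i) (b i)) := by
      rw [hX]; ext x; simp only [Set.mem_setOf_eq, Set.mem_pi, Set.mem_univ, true_imp_iff]
    rw [this]
    exact convex_pi (fun i _ => convex_Icc _ _)
  have key : ∀ i, ∃ z ∈ X, f xs i - f y i = (J z).mulVec (xs - y) i := by
    intro i
    obtain ⟨z, hz, h⟩ := domain_mvt (f := fun x => f x i) (s := X) (x := y) (y := xs)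
      (f' := fun x => (ContinuousLinearMap.proj i).comp
        ((Matrix.mulVecLin (J x)).toContinuousLinearMap))
      (fun x hx => ((hasFDerivAt_pi'.1 (hf x (hXU hx))) i).hasFDerivWithinAt) hconv hy hxs
    exact ⟨z, hconv.segment_subset hy hxs hz, h⟩
  choose z hz h using key
  let A : Matrix (Fin n) (Fin n) ℝ := Matrix.of fun i j => J (z i) i j
  have hA : A ∈ 𝒜 := by
    rw [h𝒜]
    exact fun i j => hencl (z i) (hz i) i j
  have hmul : A.mulVec (xs - y) = - f y := by
    funext i
    have h1 := h i
    rw [h0] at h1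
    have h2 : A.mulVec (xs - y) i = (J (z i)).mulVec (xs - y) i := rfl
    rw [h2, ← h1]
    simp
  have hmem : xs ∈ K ∩ X := by
    refine ⟨?_, hxs⟩
    rw [hK]
    refine ⟨xs, hxs, A, hA, ?_⟩
    rw [Matrix.sub_mulVec, Matrix.one_mulVec, ← Matrix.mulVec_mulVec, hmul, Matrix.mulVec_neg]
    abel
  rw [hdisj] at hmem
  exact hmem
end

section
/- Let E be the Euclidean space ℝⁿ and let f : E → E be a map. Let x̄ ∈ E and ω > 0 be such that f is differentiable on the closed ball B̄(x̄, ω) with derivative f'. Suppose: (1) f'(x̄) is invertible and there are real numbers B > 0 and η > 0 with ‖f'(x̄)⁻¹‖ ≤ B (operator norm) and ‖f'(x̄)⁻¹ · f(x̄)‖ ≤ η; (2) there is K > 0 such that f' is Lipschitz on B̄(x̄, ω): ‖f'(x) − f'(y)‖ ≤ K‖x − y‖ for all x, y ∈ B̄(x̄, ω); (3) h := B·K·η satisfies h ≤ 1/2, and ω satisfies ((1 − √(1 − 2h))/h)·η ≤ ω < ((1 + √(1 − 2h))/h)·η. Then f has exactly one zero in the closed ball B̄(x̄, ω): there exists a unique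 x* with ‖x* − x̄‖ ≤ ω and f(x*) = 0. -/
open Metric

theorem nk_aux {E : Type*} [NormedAddCommGroup E] [NormedSpace ℝ E]
    (T : E → E) (T' : E → E →L[ℝ] E) (c : E) (w M : ℝ) (hM : 0 ≤ M)
    (hT : ∀ x ∈ closedBall c w, HasFDerivWithinAt T (T' x) (closedBall c w) x)
    (hb : ∀ x ∈ closedBall c w, ‖T' x‖ ≤ M * ‖x - c‖)
    (x y : E) (hx : x ∈ closedBall c w) (hy : y ∈ closedBall c w) :
    ‖T y - T x‖ ≤ M * (‖x - c‖ + ‖y - c‖) / 2 * ‖y - x‖ := by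
  have hmem : ∀ s ∈ Set.Icc (0:ℝ) 1, x + s • (y - x) ∈ closedBall c w := fun s hs =>
    (convex_closedBall c w).add_smul_sub_mem hx hy hs
  have hd : ∀ s ∈ Set.Icc (0:ℝ) 1, HasDerivWithinAt (fun s : ℝ => T (x + s • (y - x)) - T x)
      (T' (x + s • (y - x)) (y - x)) (Set.Icc 0 1) s := by
    intro s hs
    have h1 : HasDerivWithinAt (fun s : ℝ => x + s • (y - x)) (y - x) (Set.Icc 0 1) s := by
      have := ((hasDerivAt_id s).smul_const (y - x)).const_add x
      simpa using this.hasDerivWithinAt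
    exact ((hT _ (hmem s hs)).comp_hasDerivWithinAt s h1 hmem).sub_const _
  have key := image_norm_le_of_norm_deriv_right_le_deriv_boundary'
    (f := fun s : ℝ => T (x + s • (y - x)) - T x) (a := 0) (b := 1)
    (f' := fun s => T' (x + s • (y - x)) (y - x))
    (B := fun s => M * ‖y - x‖ * (s * ‖x - c‖ + s ^ 2 / 2 * (‖y - c‖ - ‖x - c‖)))
    (B' := fun s => M * ‖y - x‖ * (‖x - c‖ + s * (‖y - c‖ - ‖x - c‖)))
    (fun s hs => (hd s hs).continuousWithinAt)
    (fun s hs => (hd s ⟨hs.1, hs.2.le⟩).mono_of_mem_nhdsWithin (Icc_mem_nhdsGE_of_mem hs))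
    (by simp)
    (by fun_prop)
    (fun s hs => by
      have h2 := ((((hasDerivAt_id s).mul_const ‖x - c‖).add
        ((((hasDerivAt_id s).pow 2).div_const 2).mul_const (‖y - c‖ - ‖x - c‖))).const_mul
          (M * ‖y - x‖))
      refine (h2.congr_deriv ?_).hasDerivWithinAt
      simp)
    (fun s hs => by
      have hs' : s ∈ Set.Icc (0:ℝ) 1 := ⟨hs.1, hs.2.le⟩
      have e : x + s • (y - x) - c = (1 - s) • (x - c) + s • (y - c) := by
        module
      have h3 : ‖x + s • (y - x) - c‖ ≤ (1 - s) * ‖x - c‖ + s * ‖y - c‖ := by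
        rw [e]
        refine (norm_add_le _ _).trans ?_
        rw [norm_smul, norm_smul, Real.norm_of_nonneg hs'.1,
          Real.norm_of_nonneg (by linarith [hs'.2])]
      calc ‖T' (x + s • (y - x)) (y - x)‖ ≤ ‖T' (x + s • (y - x))‖ * ‖y - x‖ :=
            ContinuousLinearMap.le_opNorm _ _
        _ ≤ (M * ((1 - s) * ‖x - c‖ + s * ‖y - c‖)) * ‖y - x‖ := by
            gcongr
            exact (hb _ (hmem s hs')).trans (by gcongr)
        _ = _ := by ring)
  have := key (x := 1) ⟨zero_le_one, le_rfl⟩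
  simp only [one_smul, add_sub_cancel] at this
  refine this.trans (le_of_eq ?_)
  ring

/-- Proposition 3.1 (Newton–Kantorovich): under bounds on the inverse of the
derivative at an approximate root, a Lipschitz condition on the derivative, and
`h = B·K·η ≤ 1/2` with `ω` in the Kantorovich range, `f` has exactly one zero in
the closed ball of radius `ω` around the approximate root. -/
theorem newton_kantorovich_unique_zero
    (n : ℕ) (f : EuclideanSpace ℝ (Fin n) → EuclideanSpace ℝ (Fin n))
    (f' : EuclideanSpace ℝ (Fin n) → (EuclideanSpace ℝ (Fin n) →L[ℝ] EuclideanSpace ℝ (Fin n)))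
    (xbar : EuclideanSpace ℝ (Fin n)) (ω : ℝ) (hω : 0 < ω)
    (hdiff : ∀ x ∈ closedBall xbar ω, HasFDerivWithinAt f (f' x) (closedBall xbar ω) x)
    (g : EuclideanSpace ℝ (Fin n) →L[ℝ] EuclideanSpace ℝ (Fin n))
    (hg₁ : g.comp (f' xbar) = ContinuousLinearMap.id ℝ (EuclideanSpace ℝ (Fin n)))
    (hg₂ : (f' xbar).comp g = ContinuousLinearMap.id ℝ (EuclideanSpace ℝ (Fin n)))
    (B η K : ℝ) (hB : 0 < B) (hη : 0 < η) (hK : 0 < K)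
    (hgB : ‖g‖ ≤ B) (hgη : ‖g (f xbar)‖ ≤ η)
    (hLip : ∀ x ∈ closedBall xbar ω, ∀ y ∈ closedBall xbar ω, ‖f' x - f' y‖ ≤ K * ‖x - y‖)
    (h : ℝ) (hh : h = B * K * η) (hhalf : h ≤ 1 / 2)
    (hωlo : ((1 - Real.sqrt (1 - 2 * h)) / h) * η ≤ ω)
    (hωhi : ω < ((1 + Real.sqrt (1 - 2 * h)) / h) * η) :
    ∃! xs, ‖xs - xbar‖ ≤ ω ∧ f xs = 0 := by
  have hM : 0 < B * K := mul_pos hB hK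
  have hh0 : 0 < h := hh ▸ mul_pos hM hη
  obtain ⟨q, hq⟩ : ∃ q, q = Real.sqrt (1 - 2 * h) := ⟨_, rfl⟩
  have hq0 : 0 ≤ q := hq ▸ Real.sqrt_nonneg _
  have hq2 : q ^ 2 = 1 - 2 * h := by rw [hq]; exact Real.sq_sqrt (by linarith)
  rw [← hq] at hωlo hωhi
  obtain ⟨M, hMd⟩ : ∃ M, M = B * K := ⟨_, rfl⟩
  rw [← hMd] at hM hh
  have e1 : (1 - q) / h * η = (1 - q) / M := by rw [hh]; field_simp
  have e2 : (1 + q) / h * η = (1 + q) / M := by rw [hh]; field_simp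
  rw [e1] at hωlo
  rw [e2] at hωhi
  have hq1 : q < 1 := by nlinarith
  have hqpos : 0 < q := by
    have := hωlo.trans_lt hωhi
    rw [div_lt_div_iff_of_pos_right hM] at this
    linarith
  obtain ⟨r, hr⟩ : ∃ r, r = (1 - q) / M := ⟨_, rfl⟩
  rw [← hr] at hωlo
  have hMr : M * r = 1 - q := by rw [hr]; field_simp
  have hMω : M * ω < 1 + q := by rw [lt_div_iff₀ hM] at hωhi; linarith
  have hr0 : 0 < r := by rw [hr]; exact div_pos (by linarith) hM
  have hreq : M * r / 2 * r + η = r := by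
    have : M * (M * r / 2 * r + η) = M * r := by
      have : M * (M * r / 2 * r + η) = (M * r) ^ 2 / 2 + h := by rw [hh]; ring
      rw [this, hMr]; nlinarith
    exact mul_left_cancel₀ hM.ne' this
  have key := nk_aux (fun x => x - g (f x))
    (fun x => ContinuousLinearMap.id ℝ _ - g.comp (f' x)) xbar ω M hM.le
    (fun x hx => (hasFDerivWithinAt_id x _).sub (g.hasFDerivAt.comp_hasFDerivWithinAt x (hdiff x hx)))
    (fun x hx => by
      have : ContinuousLinearMap.id ℝ _ - g.comp (f' x) = g.comp (f' xbar - f' x) := by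
        rw [ContinuousLinearMap.comp_sub, hg₁]
      rw [this]
      refine (ContinuousLinearMap.opNorm_comp_le _ _).trans ?_
      have h1 := hLip xbar (mem_closedBall_self hω.le) x hx
      rw [norm_sub_rev xbar x] at h1
      rw [hMd, mul_assoc]
      exact mul_le_mul hgB h1 (norm_nonneg _) hB.le)
  have hsub : closedBall xbar r ⊆ closedBall xbar ω := closedBall_subset_closedBall hωlo
  have hmaps : Set.MapsTo (fun x => x - g (f x)) (closedBall xbar r) (closedBall xbar r) := by
    intro x hx
    have h1 := key xbar x (mem_closedBall_self hω.le) (hsub hx)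
    rw [mem_closedBall, dist_eq_norm] at hx ⊢
    have h2 : x - g (f x) - xbar = (x - g (f x) - (xbar - g (f xbar))) + (- g (f xbar)) := by abel
    rw [h2]
    refine (norm_add_le _ _).trans ?_
    rw [norm_neg]
    simp only [sub_self, norm_zero, zero_add] at h1
    have h3 : M * ‖x - xbar‖ / 2 * ‖x - xbar‖ ≤ M * r / 2 * r := by gcongr
    linarith
  have hc : ContractingWith (1 - q).toNNReal (hmaps.restrict _ _ _) := by
    refine ⟨by rw [Real.toNNReal_lt_one]; linarith, LipschitzWith.of_dist_le_mul ?_⟩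
    rintro ⟨x, hx⟩ ⟨y, hy⟩
    have h1 := key y x (hsub hy) (hsub hx)
    rw [Real.coe_toNNReal _ (by linarith)]
    rw [Subtype.dist_eq, Subtype.dist_eq, dist_eq_norm, dist_eq_norm]
    refine h1.trans ?_
    rw [mem_closedBall, dist_eq_norm] at hx hy
    rw [← hMr]
    refine mul_le_mul_of_nonneg_right ?_ (norm_nonneg _)
    nlinarith
  obtain ⟨z, hz, hfix, -⟩ := ContractingWith.exists_fixedPoint' isClosed_closedBall.isComplete hmaps hc
    (mem_closedBall_self hr0.le) (edist_ne_top _ _)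
  have hfz : f z = 0 := by
    have h1 : g (f z) = 0 := by
      have : z - g (f z) = z := hfix
      simpa using this
    have h2 := congrArg (fun L => L (f z)) hg₂
    simpa [h1] using h2.symm
  have hzr : ‖z - xbar‖ ≤ r := by rwa [mem_closedBall, dist_eq_norm] at hz
  refine ⟨z, ⟨hzr.trans hωlo, hfz⟩, ?_⟩
  rintro y ⟨hy, hfy⟩
  have h1 := key z y (hsub hz) (by rwa [mem_closedBall, dist_eq_norm])
  simp only [hfz, hfy, map_zero, sub_zero] at h1
  by_contra hne
  have hpos : 0 < ‖y - z‖ := norm_pos_iff.2 (sub_ne_zero.2 hne)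
  have h2 : M * (‖z - xbar‖ + ‖y - xbar‖) / 2 < 1 := by nlinarith
  nlinarith
end

section
/- Let F : ℝⁿ → ℝⁿ and f : ℝⁿ → ℝ be functions, let x̂ ∈ ℝⁿ satisfy F(x̂) = 0, and suppose both sign certificates hold: (1) there exist sets Z₁, …, Z_m ⊆ ℝⁿ × ℝ covering every real solution of the system F(x) = 0, y²·f(x) + 1 = 0, with x̂ ∉ π(Z_i) for all i; and (2) there exist sets W₁, …, W_k ⊆ ℝⁿ × ℝ covering every real solution of the system F(x) = 0, y²·f(x) − 1 = 0, with x̂ ∉ π(W_j) for all j. Then f(x̂) = 0. -/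
/-- Correctness of the algorithm `Deter_Sign`: if both sign certificates hold —
coverings of the real solutions of `F x = 0, y²·f x + 1 = 0` and of
`F x = 0, y²·f x − 1 = 0` whose projections all avoid the root `xhat` of `F` —
then `f(xhat) = 0`. -/
theorem deter_sign_zero
    (n m k : ℕ) (F : (Fin n → ℝ) → (Fin n → ℝ)) (f : (Fin n → ℝ) → ℝ)
    (xhat : Fin n → ℝ) (hF : F xhat = 0)
    (Z : Fin m → Set ((Fin n → ℝ) × ℝ))
    (hZcover : ∀ p : (Fin n → ℝ) × ℝ, F p.1 = 0 → p.2 ^ 2 * f p.1 + 1 = 0 → ∃ i, p ∈ Z i)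
    (hZdisj : ∀ i, xhat ∉ Prod.fst '' Z i)
    (W : Fin k → Set ((Fin n → ℝ) × ℝ))
    (hWcover : ∀ p : (Fin n → ℝ) × ℝ, F p.1 = 0 → p.2 ^ 2 * f p.1 - 1 = 0 → ∃ j, p ∈ W j)
    (hWdisj : ∀ j, xhat ∉ Prod.fst '' W j) :
    f xhat = 0 := by
  rcases lt_trichotomy (f xhat) 0 with h | h | h
  · exfalso
    obtain ⟨i, hi⟩ := hZcover (xhat, Real.sqrt ((-f xhat)⁻¹)) hF (by
      have h1 : (0 : ℝ) ≤ (-f xhat)⁻¹ := inv_nonneg.mpr (by linarith)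
      have h2 : f xhat ≠ 0 := h.ne
      show Real.sqrt ((-f xhat)⁻¹) ^ 2 * f xhat + 1 = 0
      rw [Real.sq_sqrt h1, inv_neg, neg_mul, inv_mul_cancel₀ h2]
      norm_num)
    exact hZdisj i ⟨_, hi, rfl⟩
  · exact h
  · exfalso
    obtain ⟨j, hj⟩ := hWcover (xhat, Real.sqrt ((f xhat)⁻¹)) hF (by
      have h1 : (0 : ℝ) ≤ (f xhat)⁻¹ := inv_nonneg.mpr h.le
      have h2 : f xhat ≠ 0 := h.ne'
      show Real.sqrt ((f xhat)⁻¹) ^ 2 * f xhat - 1 = 0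
      rw [Real.sq_sqrt h1, inv_mul_cancel₀ h2]
      norm_num)
    exact hWdisj j ⟨_, hj, rfl⟩
end
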